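/- Let α₀,…,α₅ ∈ ℂ with α₀+α₁+2α₂+2α₃+2α₄+2α₅ = 1 and let (x,y,z,w) be a solution of the B₅⁽¹⁾ system on an open set U of times t ≠ 0. Then each of the following transformations maps it to a new solution (under the stated nonvanishing hypotheses on U): s₀: if x ≠ 1, (x, y − α₀/(x−1), z, w) with parameters (−α₀, α₁, α₂+α₀, α₃, α₄, α₅); s₁: (x,y,z,w) with (α₀, −α₁, α₂+α₁, α₃, α₄, α₅); s₂: if y ≠ 0, (x + α₂/y, y, z, w) with (α₀+α₂, α₁+α₂, −α₂, α₃+α₂, α₄, α₅); s₃: if x ≠ z, (x, y − α₃/(x−z), z, w + α₃/(x−z)) with (α₀, α₁, α₂+α₃, −α₃, α₄+α₃, α₅); s₄: if w ≠ 0, (x, y, z + α₄/w, w) with (α₀, α₁, α₂, α₃+α₄, −α₄, α₅+α₄); s₅: if z ≠ 0, the functions of s ∈ −U given by (x(−s), y(−s), z(−s), w(−s) − 2α₅/z(−s) + (−s)/z(−s)²) form a solution in the time variable s with (α₀, α₁, α₂, α₃, α₄+2α₅, −α₅); π: if x ≠ 1 and z ≠ 1, the functions of s ∈ −U given by (x/(x−1),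 −(x−1)((x−1)y+α₂), z/(z−1), −(z−1)((z−1)w+α₄)) evaluated at −s form a solution in s with (α₁, α₀, α₂, α₃, α₄, α₅). -/

import Mathlib

/-- The B₅⁽¹⁾ system (a coupled Painlevé V system in dimension four). -/
def IsSolB5 (α₀ α₁ α₂ α₃ α₄ α₅ : ℂ) (U : Set ℂ) (x y z w : ℂ → ℂ) : Prop :=
  ∀ t ∈ U,
    HasDerivAt x (-(2*(x t)^3*(y t) - 2*(x t)^2*(y t) + (α₁+2*α₂)*(x t)^2
        + (t-1+2*α₃+2*α₄+2*α₅)*(x t) - t)/t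
      - 2*((x t)-1)*(z t)*((z t)*(w t)+α₄)/t) t ∧
    HasDerivAt y ((3*(x t)^2*(y t)^2 - 2*(x t)*(y t)^2 + 2*(α₁+2*α₂)*(x t)*(y t)
        + (t-1+2*α₃+2*α₄+2*α₅)*(y t) + α₂*(α₁+α₂))/t
      + 2*(y t)*(z t)*((z t)*(w t)+α₄)/t) t ∧
    HasDerivAt z (-(2*(z t)^3*(w t) - 2*(z t)^2*(w t) + (α₁+2*α₂+α₃+2*α₄)*(z t)^2
        + (t-1+2*α₅)*(z t) - t)/t
      - 2*((x t)-1)*(y t)*(z t)^2/t) t ∧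
    HasDerivAt w ((3*(z t)^2*(w t)^2 - 2*(z t)*(w t)^2 + 2*(α₁+2*α₂+α₃+2*α₄)*(z t)*(w t)
        + (t-1+2*α₅)*(w t))/t
      + (α₄*(α₁+2*α₂+α₃+α₄) + 2*((x t)-1)*(y t)*(2*(z t)*(w t)+α₄))/t) t

/-- The derivative of a quotient with constant numerator. -/
theorem HasDerivAt.const_div_fun {f : ℂ → ℂ} {f' t : ℂ} (c : ℂ) (hf : HasDerivAt f f' t)
    (h : f t ≠ 0) : HasDerivAt (fun s => c / f s) (-(c * f') / f t ^ 2) t := by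
  simpa using (hasDerivAt_const t c).fun_div hf h

/-- The derivative of the time reversal of a function. -/
theorem HasDerivAt.comp_neg_fun {f : ℂ → ℂ} {f' s : ℂ} (hf : HasDerivAt f f' (-s)) :
    HasDerivAt (fun r => f (-r)) (-f') s := by
  simpa [Function.comp_def] using hf.comp s (hasDerivAt_neg s)

namespace IsSolB5

variable {α₀ α₁ α₂ α₃ α₄ α₅ : ℂ} {U : Set ℂ} {x y z w : ℂ → ℂ}

/-- The reflection `s₀`. -/
theorem reflect_zero (hsum : α₀ + α₁ + 2*α₂ + 2*α₃ + 2*α₄ + 2*α₅ = 1)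
    (hU0 : ∀ t ∈ U, t ≠ 0) (hsol : IsSolB5 α₀ α₁ α₂ α₃ α₄ α₅ U x y z w)
    (hx1 : ∀ t ∈ U, x t ≠ 1) :
    IsSolB5 (-α₀) α₁ (α₂+α₀) α₃ α₄ α₅ U x (fun t => y t - α₀/(x t - 1)) z w := by
  intro t ht
  obtain ⟨hx, hy, hz, hw⟩ := hsol t ht
  have h0 := hU0 t ht
  have h1 := sub_ne_zero.2 (hx1 t ht)
  obtain rfl : α₀ = 1 - α₁ - 2*α₂ - 2*α₃ - 2*α₄ - 2*α₅ := by linear_combination hsum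
  refine ⟨hx.congr_deriv ?_, (hy.fun_sub ((hx.sub_const 1).const_div_fun _ h1)).congr_deriv ?_,
    hz.congr_deriv ?_, hw.congr_deriv ?_⟩ <;> field_simp <;> ring

/-- The reflection `s₁`. -/
theorem reflect_one (hsol : IsSolB5 α₀ α₁ α₂ α₃ α₄ α₅ U x y z w) :
    IsSolB5 α₀ (-α₁) (α₂+α₁) α₃ α₄ α₅ U x y z w := by
  intro t ht
  obtain ⟨hx, hy, hz, hw⟩ := hsol t ht
  refine ⟨hx.congr_deriv ?_, hy.congr_deriv ?_, hz.congr_deriv ?_, hw.congr_deriv ?_⟩ <;> ring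

/-- The reflection `s₂`. -/
theorem reflect_two (hU0 : ∀ t ∈ U, t ≠ 0) (hsol : IsSolB5 α₀ α₁ α₂ α₃ α₄ α₅ U x y z w)
    (hy0 : ∀ t ∈ U, y t ≠ 0) :
    IsSolB5 (α₀+α₂) (α₁+α₂) (-α₂) (α₃+α₂) α₄ α₅ U (fun t => x t + α₂/(y t)) y z w := by
  intro t ht
  obtain ⟨hx, hy, hz, hw⟩ := hsol t ht
  have h0 := hU0 t ht
  have h1 := hy0 t ht
  refine ⟨(hx.fun_add (hy.const_div_fun _ h1)).congr_deriv ?_, hy.congr_deriv ?_,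
    hz.congr_deriv ?_, hw.congr_deriv ?_⟩ <;> field_simp <;> ring

/-- The reflection `s₃`. -/
theorem reflect_three (hU0 : ∀ t ∈ U, t ≠ 0) (hsol : IsSolB5 α₀ α₁ α₂ α₃ α₄ α₅ U x y z w)
    (hxz : ∀ t ∈ U, x t ≠ z t) :
    IsSolB5 α₀ α₁ (α₂+α₃) (-α₃) (α₄+α₃) α₅ U
      x (fun t => y t - α₃/(x t - z t)) z (fun t => w t + α₃/(x t - z t)) := by
  intro t ht
  obtain ⟨hx, hy, hz, hw⟩ := hsol t ht
  have h0 := hU0 t ht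
  have h1 := sub_ne_zero.2 (hxz t ht)
  have hq := (hx.fun_sub hz).const_div_fun α₃ h1
  refine ⟨hx.congr_deriv ?_, (hy.fun_sub hq).congr_deriv ?_,
    hz.congr_deriv ?_, (hw.fun_add hq).congr_deriv ?_⟩ <;> field_simp <;> ring

/-- The reflection `s₄`. -/
theorem reflect_four (hU0 : ∀ t ∈ U, t ≠ 0) (hsol : IsSolB5 α₀ α₁ α₂ α₃ α₄ α₅ U x y z w)
    (hw0 : ∀ t ∈ U, w t ≠ 0) :
    IsSolB5 α₀ α₁ α₂ (α₃+α₄) (-α₄) (α₅+α₄) U x y (fun t => z t + α₄/(w t)) w := by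
  intro t ht
  obtain ⟨hx, hy, hz, hw⟩ := hsol t ht
  have h0 := hU0 t ht
  have h1 := hw0 t ht
  refine ⟨hx.congr_deriv ?_, hy.congr_deriv ?_,
    (hz.fun_add (hw.const_div_fun _ h1)).congr_deriv ?_, hw.congr_deriv ?_⟩ <;>
    field_simp <;> ring

/-- The reflection `s₅`, which reverses time. -/
theorem reflect_five (hU0 : ∀ t ∈ U, t ≠ 0) (hsol : IsSolB5 α₀ α₁ α₂ α₃ α₄ α₅ U x y z w)
    (hz0 : ∀ t ∈ U, z t ≠ 0) :
    IsSolB5 α₀ α₁ α₂ α₃ (α₄+2*α₅) (-α₅) {s : ℂ | -s ∈ U}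
      (fun s => x (-s)) (fun s => y (-s)) (fun s => z (-s))
      (fun s => w (-s) - 2*α₅/(z (-s)) + (-s)/(z (-s))^2) := by
  intro s hs
  obtain ⟨hx, hy, hz, hw⟩ := hsol (-s) hs
  have h0 : s ≠ 0 := neg_ne_zero.1 (hU0 (-s) hs)
  have h1 := hz0 (-s) hs
  have hz' := hz.comp_neg_fun
  refine ⟨hx.comp_neg_fun.congr_deriv ?_, hy.comp_neg_fun.congr_deriv ?_, hz'.congr_deriv ?_,
    ((hw.comp_neg_fun.fun_sub (hz'.const_div_fun (2*α₅) h1)).fun_add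
      ((hasDerivAt_neg' s).fun_div (hz'.fun_pow 2) (pow_ne_zero 2 h1))).congr_deriv ?_⟩ <;>
    field_simp <;> ring

/-- The diagram automorphism `π`, which reverses time and exchanges `α₀` and `α₁`. -/
theorem diagram_automorphism (hsum : α₀ + α₁ + 2*α₂ + 2*α₃ + 2*α₄ + 2*α₅ = 1)
    (hU0 : ∀ t ∈ U, t ≠ 0) (hsol : IsSolB5 α₀ α₁ α₂ α₃ α₄ α₅ U x y z w)
    (hx1 : ∀ t ∈ U, x t ≠ 1) (hz1 : ∀ t ∈ U, z t ≠ 1) :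
    IsSolB5 α₁ α₀ α₂ α₃ α₄ α₅ {s : ℂ | -s ∈ U}
      (fun s => x (-s)/(x (-s) - 1))
      (fun s => -(x (-s) - 1)*((x (-s) - 1)*(y (-s)) + α₂))
      (fun s => z (-s)/(z (-s) - 1))
      (fun s => -(z (-s) - 1)*((z (-s) - 1)*(w (-s)) + α₄)) := by
  intro s hs
  obtain ⟨hx, hy, hz, hw⟩ := hsol (-s) hs
  have h0 : s ≠ 0 := neg_ne_zero.1 (hU0 (-s) hs)
  have h1 := sub_ne_zero.2 (hx1 (-s) hs)
  have h2 := sub_ne_zero.2 (hz1 (-s) hs)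
  obtain rfl : α₀ = 1 - α₁ - 2*α₂ - 2*α₃ - 2*α₄ - 2*α₅ := by linear_combination hsum
  have hx' := hx.comp_neg_fun
  have hz' := hz.comp_neg_fun
  have hxs := hx'.sub_const 1
  have hzs := hz'.sub_const 1
  refine ⟨(hx'.fun_div hxs h1).congr_deriv ?_,
    (hxs.fun_neg.fun_mul ((hxs.fun_mul hy.comp_neg_fun).add_const α₂)).congr_deriv ?_,
    (hz'.fun_div hzs h2).congr_deriv ?_,
    (hzs.fun_neg.fun_mul ((hzs.fun_mul hw.comp_neg_fun).add_const α₄)).congr_deriv ?_⟩ <;>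
    field_simp <;> ring

end IsSolB5

theorem backlund_B5 (α₀ α₁ α₂ α₃ α₄ α₅ : ℂ)
    (hsum : α₀ + α₁ + 2*α₂ + 2*α₃ + 2*α₄ + 2*α₅ = 1)
    (U : Set ℂ) (hU : IsOpen U) (hU0 : ∀ t ∈ U, t ≠ 0)
    (x y z w : ℂ → ℂ) (hsol : IsSolB5 α₀ α₁ α₂ α₃ α₄ α₅ U x y z w) :
    ((∀ t ∈ U, x t ≠ 1) →
      IsSolB5 (-α₀) α₁ (α₂+α₀) α₃ α₄ α₅ U
        x (fun t => y t - α₀/(x t - 1)) z w) ∧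
    IsSolB5 α₀ (-α₁) (α₂+α₁) α₃ α₄ α₅ U x y z w ∧
    ((∀ t ∈ U, y t ≠ 0) →
      IsSolB5 (α₀+α₂) (α₁+α₂) (-α₂) (α₃+α₂) α₄ α₅ U
        (fun t => x t + α₂/(y t)) y z w) ∧
    ((∀ t ∈ U, x t ≠ z t) →
      IsSolB5 α₀ α₁ (α₂+α₃) (-α₃) (α₄+α₃) α₅ U
        x (fun t => y t - α₃/(x t - z t)) z (fun t => w t + α₃/(x t - z t))) ∧
    ((∀ t ∈ U, w t ≠ 0) →
      IsSolB5 α₀ α₁ α₂ (α₃+α₄) (-α₄) (α₅+α₄) U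
        x y (fun t => z t + α₄/(w t)) w) ∧
    ((∀ t ∈ U, z t ≠ 0) →
      IsSolB5 α₀ α₁ α₂ α₃ (α₄+2*α₅) (-α₅) {s : ℂ | -s ∈ U}
        (fun s => x (-s)) (fun s => y (-s)) (fun s => z (-s))
        (fun s => w (-s) - 2*α₅/(z (-s)) + (-s)/(z (-s))^2)) ∧
    ((∀ t ∈ U, x t ≠ 1) → (∀ t ∈ U, z t ≠ 1) →
      IsSolB5 α₁ α₀ α₂ α₃ α₄ α₅ {s : ℂ | -s ∈ U}
        (fun s => x (-s)/(x (-s) - 1))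
        (fun s => -(x (-s) - 1)*((x (-s) - 1)*(y (-s)) + α₂))
        (fun s => z (-s)/(z (-s) - 1))
        (fun s => -(z (-s) - 1)*((z (-s) - 1)*(w (-s)) + α₄))) := by
  exact ⟨hsol.reflect_zero hsum hU0, hsol.reflect_one, hsol.reflect_two hU0,
    hsol.reflect_three hU0, hsol.reflect_four hU0, hsol.reflect_five hU0,
    hsol.diagram_automorphism hsum hU0⟩
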